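/- arXiv:2206.06676 — 3 statements merged into one kernel-verified Lean document; each statement's English description precedes it below -/
import Mathlib

section
/- Let q ≥ 3, 1/q < s < 1, and fix target sparsities s_R, s_{A+R} ∈ (1/q, 1). Suppose p1* ∈ [0,1] is a root of the cubic α·x³ + β·x² + γ·x + δ (with θ, α, β, γ, δ as in the context) satisfying max{ s_R + s_{A+R} − 1 + s, 0 } ≤ 2·p1*·s ≤ 2·min{ s, s_R, s_{A+R} }, and define p1inv* = (1−p1*)/(q−1), p2* = (s_{A+R} − p1*·s)/(1−s), p3* = (s_R − p1*·s)/(1−s), p23inv* = (1−p2*−p3*)/(q−2). Then (p1*, p1inv*, p2*, p3*, p23inv*) is a global minimizer of the total leakage L over all tuples (p1, p1inv, p2, p3, p23inv) ∈ [0,1]^5 satisfying the constraints p1 + (q−1)·p1inv = 1, p2 + p3 + (q−2)·p23inv = 1, p1·s + p3·(1−s) = s_R, and p1·s + p2·(1−s) = s_{A+R}. -/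
/-- The tangent-line (Gibbs) inequality for the function `x ↦ x (log (x / a) + log (x / b))`. -/
lemma mul_log_div_add_log_div_ge {a b x y : ℝ} (ha : 0 < a) (hb : 0 < b) (hx : 0 ≤ x)
    (hy : 0 < y) :
    x * (2 * Real.log y - Real.log a - Real.log b) + 2 * (x - y) ≤
      x * (Real.log (x / a) + Real.log (x / b)) := by
  rcases hx.eq_or_lt with rfl | hx
  · linarith
  · have h := mul_le_mul_of_nonneg_left
      (Real.log_le_sub_one_of_pos (div_pos hy hx)) hx.le
    rw [Real.log_div hy.ne' hx.ne', mul_sub, mul_sub, mul_div_cancel₀ _ hx.ne'] at h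
    rw [Real.log_div hx.ne' ha.ne', Real.log_div hx.ne' hb.ne']
    linarith

/-- If a feasible point of the cubic equation `u w² = θ (s - u) (a - u) (r - u)` is not interior,
then `w = 0` and `u` is equal to one of `s`, `a`, `r`. -/
lemma pos_or_boundary_of_cubic {θ s a r u w : ℝ} (hθ : 0 < θ) (hs : 0 < s) (ha : 0 < a)
    (hr : 0 < r) (hu : 0 ≤ u) (hus : u ≤ s) (hua : u ≤ a) (hur : u ≤ r) (hw : 0 ≤ w)
    (h : u * w ^ 2 = θ * (s - u) * (a - u) * (r - u)) :
    (0 < u ∧ u < s ∧ u < a ∧ u < r ∧ 0 < w) ∨ (w = 0 ∧ (u = s ∨ u = a ∨ u = r)) := by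
  have hu0 : 0 < u := by
    rcases hu.eq_or_lt with rfl | hu0
    · have : 0 < θ * (s - 0) * (a - 0) * (r - 0) := by simp only [sub_zero]; positivity
      linarith
    · exact hu0
  rcases hw.eq_or_lt with rfl | hw0
  · right
    have h0 : θ * (s - u) * (a - u) * (r - u) = 0 := by rw [← h]; ring
    simp only [mul_eq_zero, hθ.ne', false_or, sub_eq_zero] at h0
    exact ⟨rfl, by tauto⟩
  · left
    have hpos : 0 < θ * (s - u) * (a - u) * (r - u) := by rw [← h]; positivity
    refine ⟨hu0, lt_of_le_of_ne hus ?_, lt_of_le_of_ne hua ?_, lt_of_le_of_ne hur ?_, hw0⟩ <;>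
    · rintro rfl
      simp at hpos


/-- (Theorem 1 of the paper.) Let `q ≥ 3` be a prime power, `1/q < s < 1`,
and fix target sparsities `sR, sAR ∈ (1/q, 1)`. Suppose `p1s ∈ [0,1]` is a root of the cubic
`α·x³ + β·x² + γ·x + δ` satisfying
`max{sR + sAR − 1 + s, 0} ≤ 2·p1s·s ≤ 2·min{s, sR, sAR}`, and define the remaining
parameters from the linear constraints. Then `(p1s, p1invs, p2s, p3s, p23invs)` is a global
minimizer of the total leakage `L` over all tuples in `[0,1]^5` satisfying the four linear
constraints. (Here `L` uses the natural logarithm; with `Real.log 0 = 0` this encodes the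
convention `0·log 0 = 0`.) -/
theorem statement8 (q : ℕ) (hq : 3 ≤ q) (s sR sAR : ℝ)
    (hs : s ∈ Set.Ioo (1 / (q : ℝ)) 1)
    (hsR : sR ∈ Set.Ioo (1 / (q : ℝ)) 1)
    (hsAR : sAR ∈ Set.Ioo (1 / (q : ℝ)) 1)
    (θ α β γ δ : ℝ)
    (hθ : θ = ((q : ℝ) - 2) ^ 2 / ((q : ℝ) - 1))
    (hα : α = s ^ 2 * (4 + θ))
    (hβ : β = 4 * s * (1 - s - sAR - sR) - θ * s * (sR + sAR + s))
    (hγ : γ = (1 - s - sAR - sR) ^ 2 + θ * (s * sAR + s * sR + sAR * sR))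
    (hδ : δ = -θ * sAR * sR)
    (L : ℝ × ℝ × ℝ × ℝ × ℝ → ℝ)
    (hL : ∀ v : ℝ × ℝ × ℝ × ℝ × ℝ,
      L v =
        s * (v.1 * (Real.log (v.1 / sAR) + Real.log (v.1 / sR))
          + ((q : ℝ) - 1) * v.2.1 *
            (Real.log (v.2.1 / ((1 - sAR) / ((q : ℝ) - 1)))
              + Real.log (v.2.1 / ((1 - sR) / ((q : ℝ) - 1)))))
        + (1 - s) * (v.2.2.1 * (Real.log (v.2.2.1 / sAR)
              + Real.log (v.2.2.1 / ((1 - sR) / ((q : ℝ) - 1))))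
          + v.2.2.2.1 * (Real.log (v.2.2.2.1 / ((1 - sAR) / ((q : ℝ) - 1)))
              + Real.log (v.2.2.2.1 / sR))
          + ((q : ℝ) - 2) * v.2.2.2.2 *
            (Real.log (v.2.2.2.2 / ((1 - sAR) / ((q : ℝ) - 1)))
              + Real.log (v.2.2.2.2 / ((1 - sR) / ((q : ℝ) - 1))))))
    (p1s : ℝ) (hp1s : p1s ∈ Set.Icc (0 : ℝ) 1)
    (hroot : α * p1s ^ 3 + β * p1s ^ 2 + γ * p1s + δ = 0)
    (hlb : max (sR + sAR - 1 + s) 0 ≤ 2 * p1s * s)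
    (hub : 2 * p1s * s ≤ 2 * min s (min sR sAR))
    (p1invs p2s p3s p23invs : ℝ)
    (hp1invs : p1invs = (1 - p1s) / ((q : ℝ) - 1))
    (hp2s : p2s = (sAR - p1s * s) / (1 - s))
    (hp3s : p3s = (sR - p1s * s) / (1 - s))
    (hp23invs : p23invs = (1 - p2s - p3s) / ((q : ℝ) - 2)) :
    (p1s, p1invs, p2s, p3s, p23invs) ∈
      {v : ℝ × ℝ × ℝ × ℝ × ℝ |
        v.1 ∈ Set.Icc (0 : ℝ) 1 ∧ v.2.1 ∈ Set.Icc (0 : ℝ) 1 ∧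
        v.2.2.1 ∈ Set.Icc (0 : ℝ) 1 ∧ v.2.2.2.1 ∈ Set.Icc (0 : ℝ) 1 ∧
        v.2.2.2.2 ∈ Set.Icc (0 : ℝ) 1 ∧
        v.1 + ((q : ℝ) - 1) * v.2.1 = 1 ∧
        v.2.2.1 + v.2.2.2.1 + ((q : ℝ) - 2) * v.2.2.2.2 = 1 ∧
        v.1 * s + v.2.2.2.1 * (1 - s) = sR ∧
        v.1 * s + v.2.2.1 * (1 - s) = sAR} ∧
    ∀ v ∈ {v : ℝ × ℝ × ℝ × ℝ × ℝ |
        v.1 ∈ Set.Icc (0 : ℝ) 1 ∧ v.2.1 ∈ Set.Icc (0 : ℝ) 1 ∧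
        v.2.2.1 ∈ Set.Icc (0 : ℝ) 1 ∧ v.2.2.2.1 ∈ Set.Icc (0 : ℝ) 1 ∧
        v.2.2.2.2 ∈ Set.Icc (0 : ℝ) 1 ∧
        v.1 + ((q : ℝ) - 1) * v.2.1 = 1 ∧
        v.2.2.1 + v.2.2.2.1 + ((q : ℝ) - 2) * v.2.2.2.2 = 1 ∧
        v.1 * s + v.2.2.2.1 * (1 - s) = sR ∧
        v.1 * s + v.2.2.1 * (1 - s) = sAR},
      L (p1s, p1invs, p2s, p3s, p23invs) ≤ L v := by
  have hQ : (3 : ℝ) ≤ q := by exact_mod_cast hq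
  generalize (q : ℝ) = Q at *
  have hQinv : 0 < 1 / Q := by positivity
  obtain ⟨hs0, hs1⟩ := hs
  obtain ⟨hR0, hR1⟩ := hsR
  obtain ⟨hA0, hA1⟩ := hsAR
  replace hs0 := hQinv.trans hs0
  replace hR0 := hQinv.trans hR0
  replace hA0 := hQinv.trans hA0
  have hQ1 : 0 < Q - 1 := by linarith
  have hQ2 : 0 < Q - 2 := by linarith
  have hs1' : 0 < 1 - s := by linarith
  obtain ⟨hx0, hx1⟩ := hp1s
  have hlb1 := (le_max_left _ _).trans hlb
  have hus : p1s * s ≤ s := mul_le_of_le_one_left hs0.le hx1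
  have huR : p1s * s ≤ sR := by
    have := (min_le_right s (min sR sAR)).trans (min_le_left _ _)
    linarith
  have huA : p1s * s ≤ sAR := by
    have := (min_le_right s (min sR sAR)).trans (min_le_right _ _)
    linarith
  have e1 : (Q - 1) * p1invs = 1 - p1s := by rw [hp1invs]; field_simp
  have e2 : (1 - s) * p2s = sAR - p1s * s := by rw [hp2s]; field_simp
  have e3 : (1 - s) * p3s = sR - p1s * s := by rw [hp3s]; field_simp
  have e4 : (Q - 2) * p23invs = 1 - p2s - p3s := by rw [hp23invs]; field_simp
  have e5 : (1 - s) * ((Q - 2) * p23invs) = 1 - s - sAR - sR + 2 * (p1s * s) := by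
    rw [e4]; linarith
  clear hp1invs hp2s hp3s hp23invs
  have h1 : 0 ≤ p1invs := nonneg_of_mul_nonneg_right (by rw [e1]; linarith) hQ1
  have h2 : 0 ≤ p2s := nonneg_of_mul_nonneg_right (by rw [e2]; linarith) hs1'
  have h3 : 0 ≤ p3s := nonneg_of_mul_nonneg_right (by rw [e3]; linarith) hs1'
  have h4 : 0 ≤ p23invs := by
    refine nonneg_of_mul_nonneg_right
      (nonneg_of_mul_nonneg_right ?_ hs1' : 0 ≤ (Q - 2) * p23invs) hQ2
    rw [e5]; linarith
  have h5 : 0 ≤ (Q - 2) * p23invs := mul_nonneg hQ2.le h4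
  refine ⟨⟨⟨hx0, hx1⟩, ⟨h1, le_of_mul_le_mul_left (by linarith) hQ1⟩, ⟨h2, by linarith⟩,
    ⟨h3, by linarith⟩, ⟨h4, le_of_mul_le_mul_left (by linarith) hQ2⟩, by linarith, by linarith, by linarith, by linarith⟩, ?_⟩
  rintro ⟨x, y, p2, p3, z⟩ ⟨⟨gx0, gx1⟩, ⟨gy0, -⟩, ⟨g20, -⟩, ⟨g30, -⟩, ⟨gz0, -⟩, c1, c2, c3, c4⟩
  dsimp only at gx0 gx1 gy0 g20 g30 gz0 c1 c2 c3 c4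
  have hθ0 : 0 < θ := by rw [hθ]; positivity
  have hcubic : (p1s * s) * (1 - s - sAR - sR + 2 * (p1s * s)) ^ 2 =
      θ * (s - p1s * s) * (sAR - p1s * s) * (sR - p1s * s) := by
    subst hα hβ hγ hδ
    linear_combination s * hroot
  have gz : (1 - s) * ((Q - 2) * z) = 1 - s - sAR - sR + 2 * (x * s) := by
    linear_combination (1 - s) * c2 - c3 - c4
  rcases pos_or_boundary_of_cubic hθ0 hs0 hA0 hR0 (by positivity) hus huA huR (by linarith) hcubic
    with ⟨hu, hus, huA, huR, hw⟩ | ⟨hw, hb⟩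
  · have hx : 0 < p1s := pos_of_mul_pos_left hu hs0.le
    have hx1 : p1s < 1 := by
      by_contra! h
      linarith [mul_le_mul_of_nonneg_right h hs0.le]
    have k1 : 0 < p1invs := pos_of_mul_pos_right (by rw [e1]; linarith) hQ1.le
    have k2 : 0 < p2s := pos_of_mul_pos_right (by rw [e2]; linarith) hs1'.le
    have k3 : 0 < p3s := pos_of_mul_pos_right (by rw [e3]; linarith) hs1'.le
    have k4 : 0 < p23invs := by
      refine pos_of_mul_pos_right (pos_of_mul_pos_right ?_ hs1'.le : 0 < (Q - 2) * p23invs) hQ2.le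
      rw [e5]; linarith
    have hprod : p1s * p23invs ^ 2 = p1invs * p2s * p3s := by
      have hθ' : θ * (Q - 1) = (Q - 2) ^ 2 := by rw [hθ]; field_simp
      have hsub : s - p1s * s = s * ((Q - 1) * p1invs) := by rw [e1]; ring
      rw [← e5, ← e2, ← e3, hsub] at hcubic
      have hne : s * (1 - s) ^ 2 * (Q - 2) ^ 2 ≠ 0 := by positivity
      apply mul_left_cancel₀ hne
      linear_combination hcubic + s * (1 - s) ^ 2 * p1invs * p2s * p3s * hθ'
    have hlog : Real.log p1s + 2 * Real.log p23invs =
        Real.log p1invs + Real.log p2s + Real.log p3s := by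
      have := congrArg Real.log hprod
      rw [Real.log_mul hx.ne' (by positivity), Real.log_pow, Real.log_mul (by positivity) k3.ne',
        Real.log_mul k1.ne' k2.ne'] at this
      exact_mod_cast this
    have hA' : 0 < (1 - sAR) / (Q - 1) := div_pos (by linarith) hQ1
    have hR' : 0 < (1 - sR) / (Q - 1) := div_pos (by linarith) hQ1
    rw [hL, hL]
    dsimp only
    generalize (1 - sAR) / (Q - 1) = A' at *
    generalize (1 - sR) / (Q - 1) = R' at *
    have t1 := mul_le_mul_of_nonneg_left (mul_log_div_add_log_div_ge hA0 hR0 gx0 hx) hs0.le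
    have t2 := mul_le_mul_of_nonneg_left (mul_log_div_add_log_div_ge hA' hR' gy0 k1)
      (mul_pos hs0 hQ1).le
    have t3 := mul_le_mul_of_nonneg_left (mul_log_div_add_log_div_ge hA0 hR' g20 k2) hs1'.le
    have t4 := mul_le_mul_of_nonneg_left (mul_log_div_add_log_div_ge hA' hR0 g30 k3) hs1'.le
    have t5 := mul_le_mul_of_nonneg_left (mul_log_div_add_log_div_ge hA' hR' gz0 k4)
      (mul_pos hs1' hQ2).le
    simp only [Real.log_div hx.ne' hA0.ne', Real.log_div hx.ne' hR0.ne',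
      Real.log_div k1.ne' hA'.ne', Real.log_div k1.ne' hR'.ne',
      Real.log_div k2.ne' hA0.ne', Real.log_div k2.ne' hR'.ne',
      Real.log_div k3.ne' hA'.ne', Real.log_div k3.ne' hR0.ne',
      Real.log_div k4.ne' hA'.ne', Real.log_div k4.ne' hR'.ne']
    have d1 : s * (Q - 1) * (y - p1invs) = -(s * (x - p1s)) := by
      linear_combination s * c1 - s * e1
    have d2 : (1 - s) * (p2 - p2s) = -(s * (x - p1s)) := by linear_combination c4 - e2
    have d3 : (1 - s) * (p3 - p3s) = -(s * (x - p1s)) := by linear_combination c3 - e3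
    have d4 : (1 - s) * (Q - 2) * (z - p23invs) = 2 * (s * (x - p1s)) := by
      linear_combination gz - e5
    have key : s * (x - p1s) * (2 * Real.log p1s - Real.log sAR - Real.log sR + 2)
        + s * (Q - 1) * (y - p1invs) * (2 * Real.log p1invs - Real.log A' - Real.log R' + 2)
        + (1 - s) * (p2 - p2s) * (2 * Real.log p2s - Real.log sAR - Real.log R' + 2)
        + (1 - s) * (p3 - p3s) * (2 * Real.log p3s - Real.log A' - Real.log sR + 2)
        + (1 - s) * (Q - 2) * (z - p23invs)
          * (2 * Real.log p23invs - Real.log A' - Real.log R' + 2) = 0 := by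
      rw [d1, d2, d3, d4]
      linear_combination 2 * (s * (x - p1s)) * hlog
    linarith
  · have hz : 0 ≤ (1 - s) * ((Q - 2) * z) := by positivity
    have hle : p1s * s ≤ x * s := by linarith
    have hxu : x * s = p1s * s := by
      refine le_antisymm ?_ hle
      rcases hb with hb | hb | hb <;> rw [hb]
      · exact mul_le_of_le_one_left hs0.le gx1
      · linarith [mul_nonneg g20 hs1'.le]
      · linarith [mul_nonneg g30 hs1'.le]
    have q1 : x = p1s := mul_right_cancel₀ hs0.ne' hxu
    have q2 : y = p1invs := mul_left_cancel₀ hQ1.ne' (by linarith)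
    have q3 : p2 = p2s := mul_left_cancel₀ hs1'.ne' (by linarith)
    have q4 : p3 = p3s := mul_left_cancel₀ hs1'.ne' (by linarith)
    have q5 : z = p23invs := mul_left_cancel₀ hQ2.ne' (by linarith)
    rw [q1, q2, q3, q4, q5]
end

section
/- Let n be a positive even integer and ξ an integer with 0 ≤ ξ ≤ n/2 − 1. For each node i ∈ Z_n (integers modulo n), let T_i = { i + j mod n : 0 ≤ j ≤ ξ } be the set of sub-share indices of type (A+R) held by node i, and U_i = { n/2 + i + j mod n : 0 ≤ j ≤ ξ } the set of sub-share indices of type R held by node i. Then for every subset S ⊆ Z_n with |S| ≥ n − ξ, the union ⋃_{i∈S} T_i = Z_n and the union ⋃_{i∈S} U_i = Z_n; that is, any n − ξ nodes jointly hold all n sub-shares of (A+R) and all n sub-shares of R. -/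
theorem ZMod.exists_mem_add_natCast_eq {n ξ : ℕ} [NeZero n] (hξ : ξ < n)
    {S : Finset (ZMod n)} (hS : n - ξ ≤ S.card) (m : ZMod n) :
    ∃ i ∈ S, ∃ j < ξ + 1, i + (j : ZMod n) = m := by
  let B : Finset (ZMod n) := (Finset.range (ξ + 1)).image fun j : ℕ => m - (j : ZMod n)
  have hB : B.card = ξ + 1 := by
    rw [Finset.card_image_of_injOn, Finset.card_range]
    intro a ha b hb hab
    simp only [Finset.coe_range, Set.mem_Iio] at ha hb
    have h : (a : ZMod n) = b := sub_right_injective hab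
    rw [ZMod.natCast_eq_natCast_iff'] at h
    rwa [Nat.mod_eq_of_lt (by omega), Nat.mod_eq_of_lt (by omega)] at h
  have hcard : (Finset.univ : Finset (ZMod n)).card < S.card + B.card := by
    rw [Finset.card_univ, ZMod.card, hB]
    omega
  obtain ⟨i, hi⟩ := Finset.inter_nonempty_of_card_lt_card_add_card
    (Finset.subset_univ S) (Finset.subset_univ B) hcard
  obtain ⟨hiS, hiB⟩ := Finset.mem_inter.mp hi
  obtain ⟨j, hj, rfl⟩ := Finset.mem_image.mp hiB
  exact ⟨_, hiS, j, Finset.mem_range.mp hj, sub_add_cancel _ _⟩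

/-- Let `n` be a positive even integer and `0 ≤ ξ ≤ n/2 − 1`. For each
node `i ∈ Z_n`, let `T i = {i + j mod n : 0 ≤ j ≤ ξ}` (indices of `(A+R)`-type sub-shares)
and `U i = {n/2 + i + j mod n : 0 ≤ j ≤ ξ}` (indices of `R`-type sub-shares). Then any
subset `S ⊆ Z_n` with `|S| ≥ n − ξ` satisfies `⋃_{i ∈ S} T i = Z_n` and
`⋃_{i ∈ S} U i = Z_n`: any `n − ξ` nodes jointly hold all sub-shares of both types. -/
theorem statement10 (n ξ : ℕ) [NeZero n] (hn : Even n) (hξ : ξ ≤ n / 2 - 1)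
    (T U : ZMod n → Finset (ZMod n))
    (hT : ∀ i, T i = (Finset.range (ξ + 1)).image (fun (j : ℕ) => i + (j : ZMod n)))
    (hU : ∀ i, U i = (Finset.range (ξ + 1)).image
      (fun (j : ℕ) => ((n / 2 : ℕ) : ZMod n) + i + (j : ZMod n))) :
    ∀ S : Finset (ZMod n), n - ξ ≤ S.card →
      S.biUnion T = Finset.univ ∧ S.biUnion U = Finset.univ := by
  intro S hS
  have hlt : ξ < n := by
    have := NeZero.pos n
    omega
  refine ⟨Finset.eq_univ_of_forall fun m => ?_, Finset.eq_univ_of_forall fun m => ?_⟩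
  · obtain ⟨i, hi, j, hj, hij⟩ := ZMod.exists_mem_add_natCast_eq hlt hS m
    rw [Finset.mem_biUnion]
    refine ⟨i, hi, ?_⟩
    rw [hT]
    exact Finset.mem_image.mpr ⟨j, Finset.mem_range.mpr hj, hij⟩
  · obtain ⟨i, hi, j, hj, hij⟩ :=
      ZMod.exists_mem_add_natCast_eq hlt hS (m - ((n / 2 : ℕ) : ZMod n))
    rw [Finset.mem_biUnion]
    refine ⟨i, hi, ?_⟩
    rw [hU]
    refine Finset.mem_image.mpr ⟨j, Finset.mem_range.mpr hj, ?_⟩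
    rw [add_assoc, hij, add_sub_cancel]
end

section
/- Let A be an r×ℓ random matrix over F_q with i.i.d. entries, and let R be generated entry-wise conditionally on A (entries of (A,R) i.i.d. across positions), with per-entry leakages ε1 = I_q(A_{i,j}; R_{i,j}) and ε2 = I_q(A_{i,j}; A_{i,j}+R_{i,j}). Let n be even with n | r, 0 ≤ ξ ≤ n/2 − 1, and partition R and A+R row-wise into n sub-shares of r/n rows each. If node i stores the sub-shares (A+R)_m for m ∈ { i+j mod n : 0 ≤ j ≤ ξ } and R_m for m ∈ { n/2+i+j mod n : 0 ≤ j ≤ ξ }, then the information leaked to node i about A equals I_q(A; stored data of node i) = (ξ+1)·(r·ℓ/n)·(ε1 + ε2) = (ξ+1)·(L1+L2)/n, where L1 = I_q(A;R) = r·ℓ·ε1 and L2 = I_q(A;A+R) = r·ℓ·ε2 are the leakages of the full shares. -/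
/-- The mutual information, in units of `log q`, of a joint weight function `v` on `A × B`. -/
noncomputable def mutualInfo {A B : Type*} [Fintype A] [Fintype B] (q : ℕ) (v : A → B → ℝ) : ℝ :=
  ∑ a, ∑ b, v a b * Real.logb q (v a b / ((∑ b', v a b') * ∑ a', v a' b))

section MutualInfo

variable {ι A B D : Type*} [Fintype ι] [DecidableEq ι] [Fintype A] [Fintype B] [Fintype D]

theorem sum_prod_apply (f : ι → A → ℝ) : ∑ X : ι → A, ∏ c, f c (X c) = ∏ c, ∑ a, f c a := by
  classical
  rw [Finset.prod_univ_sum, Fintype.piFinset_univ]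

/-- The expectation of a function of one coordinate under a product of probability weights. -/
theorem sum_prod_mul_apply (f : ι → A → ℝ) (hf : ∀ c, ∑ a, f c a = 1) (c : ι) (l : A → ℝ) :
    ∑ X : ι → A, (∏ c', f c' (X c')) * l (X c) = ∑ a, f c a * l a := by
  have h : ∀ X : ι → A, (∏ c', f c' (X c')) * l (X c) =
      ∏ c', f c' (X c') * (if c' = c then l (X c') else 1) := by
    intro X
    rw [Finset.prod_mul_distrib, Finset.prod_ite_eq' Finset.univ c]
    simp
  simp_rw [h]
  rw [sum_prod_apply (fun c' a => f c' a * (if c' = c then l a else 1)),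
    Finset.prod_eq_single c]
  · simp
  · intro b _ hb
    simp [hb, hf]
  · simp

theorem sum_sum_pi (f : (ι → A) → (ι → B) → ℝ) :
    ∑ X : ι → A, ∑ Y : ι → B, f X Y =
      ∑ Z : ι → A × B, f (fun c => (Z c).1) (fun c => (Z c).2) := by
  classical
  rw [← Fintype.sum_prod_type']
  exact (Fintype.sum_equiv (Equiv.arrowProdEquivProdArrow ι (fun _ => A) (fun _ => B)) _ _
    (fun _ => rfl)).symm

/-- Mutual information is additive over independent positions. -/
theorem mutualInfo_prod (q : ℕ) (v : ι → A → B → ℝ) (hv : ∀ c a b, 0 ≤ v c a b)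
    (hsum : ∀ c, ∑ a, ∑ b, v c a b = 1) :
    mutualInfo q (fun (X : ι → A) (Y : ι → B) => ∏ c, v c (X c) (Y c)) =
      ∑ c, mutualInfo q (v c) := by
  set l : ι → A × B → ℝ := fun c z =>
    Real.logb q (v c z.1 z.2 / ((∑ b', v c z.1 b') * ∑ a', v c a' z.2)) with hl
  have key : ∀ Z : ι → A × B, (∏ c, v c (Z c).1 (Z c).2) *
      Real.logb q ((∏ c, v c (Z c).1 (Z c).2) /
        ((∑ Y : ι → B, ∏ c, v c (Z c).1 (Y c)) * ∑ X : ι → A, ∏ c, v c (X c) (Z c).2)) =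
      ∑ c, (∏ c', v c' (Z c').1 (Z c').2) * l c (Z c) := by
    intro Z
    rw [sum_prod_apply (fun c b => v c (Z c).1 b),
      sum_prod_apply (fun c a => v c a (Z c).2), ← Finset.prod_mul_distrib,
      ← Finset.prod_div_distrib, ← Finset.mul_sum]
    by_cases h0 : ∏ c, v c (Z c).1 (Z c).2 = 0
    · simp [h0]
    congr 1
    refine Real.logb_prod _ _ fun c _ => ?_
    have hpos : 0 < v c (Z c).1 (Z c).2 :=
      lt_of_le_of_ne (hv _ _ _) (Ne.symm (Finset.prod_ne_zero_iff.1 h0 c (Finset.mem_univ c)))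
    have h1 : 0 < ∑ b', v c (Z c).1 b' :=
      hpos.trans_le (Finset.single_le_sum (f := fun b' => v c (Z c).1 b')
        (fun b' _ => hv _ _ b') (Finset.mem_univ _))
    have h2 : 0 < ∑ a', v c a' (Z c).2 :=
      hpos.trans_le (Finset.single_le_sum (f := fun a' => v c a' (Z c).2)
        (fun a' _ => hv _ a' _) (Finset.mem_univ _))
    positivity
  unfold mutualInfo
  rw [sum_sum_pi]
  simp_rw [key]
  rw [Finset.sum_comm]
  refine Finset.sum_congr rfl fun c _ => ?_
  rw [sum_prod_mul_apply (fun c z => v c z.1 z.2)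
    (fun c => by rw [Fintype.sum_prod_type]; exact hsum c) c (l c), Fintype.sum_prod_type]

/-- Relabelling the second variable injectively preserves mutual information. -/
theorem mutualInfo_map_injective [DecidableEq B] (q : ℕ) (v : A → D → ℝ) (h : D → B)
    (hh : Function.Injective h) :
    mutualInfo q (fun a b => ∑ d, if h d = b then v a d else 0) = mutualInfo q v := by
  have hpush : ∀ (a : A) (L : B → ℝ),
      ∑ b, (∑ d, if h d = b then v a d else 0) * L b = ∑ d, v a d * L (h d) := by
    intro a L
    simp_rw [Finset.sum_mul]
    rw [Finset.sum_comm]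
    refine Finset.sum_congr rfl fun d _ => ?_
    simp [ite_mul]
  have hval : ∀ a d, (∑ d', if h d' = h d then v a d' else 0) = v a d := by
    intro a d
    classical
    simp [hh.eq_iff]
  have hmarg : ∀ a, ∑ b, (∑ d, if h d = b then v a d else 0) = ∑ d, v a d := by
    intro a
    simpa using hpush a (fun _ => 1)
  unfold mutualInfo
  refine Finset.sum_congr rfl fun a _ => ?_
  rw [hpush a]
  simp_rw [hval, hmarg]

theorem mutualInfo_unit (q : ℕ) (v : A → Unit → ℝ) (hsum : ∑ a, v a () = 1) :
    mutualInfo q v = 0 := by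
  unfold mutualInfo
  refine Finset.sum_eq_zero fun a _ => ?_
  by_cases h : v a () = 0
  · simp [h]
  · simp [hsum, h]

/-- Mutual information when the second variable is a pair of functions, listed coordinatewise. -/
theorem mutualInfo_arrowProd (q : ℕ) (v : A → (ι → B) × (ι → D) → ℝ) :
    mutualInfo q v =
      mutualInfo q (fun a (d : ι → B × D) => v a (fun c => (d c).1, fun c => (d c).2)) := by
  classical
  have h : ∀ f : (ι → B) × (ι → D) → ℝ,
      ∑ d, f d = ∑ d : ι → B × D, f (fun c => (d c).1, fun c => (d c).2) := fun f =>
    (Fintype.sum_equiv (Equiv.arrowProdEquivProdArrow ι (fun _ => B) (fun _ => D)) _ _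
      (fun _ => rfl)).symm
  unfold mutualInfo
  simp_rw [h]

end MutualInfo

section Mask

variable {F : Type*} [Field F] [Fintype F]

theorem sum_shift (x : F) (f : F → ℝ) : ∑ z, f (z - x) = ∑ y, f y :=
  Fintype.sum_equiv (Equiv.subRight x) _ _ (fun _ => rfl)

variable [DecidableEq F]

/-- The joint weight of one entry `x` and the part of `(x + y, y)` selected by `T` and `U`. -/
def maskedWeight (p : F → F → ℝ) (T U : Prop) [Decidable T] [Decidable U] (x : F) (d : F × F) :
    ℝ :=
  ∑ y, if ((if T then x + y else 0), (if U then y else 0)) = d then p x y else 0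

theorem sum_maskedWeight (p : F → F → ℝ) (T U : Prop) [Decidable T] [Decidable U] (x : F) :
    ∑ d, maskedWeight p T U x d = ∑ y, p x y := by
  unfold maskedWeight
  rw [Finset.sum_comm]
  simp

theorem mutualInfo_maskedWeight (q : ℕ) (p : F → F → ℝ) (hpsum : ∑ x, ∑ y, p x y = 1)
    (T U : Prop) [Decidable T] [Decidable U] (hTU : ¬(T ∧ U)) :
    mutualInfo q (maskedWeight p T U) =
      (if T then mutualInfo q (fun x z => p x (z - x)) else 0) +
        (if U then mutualInfo q p else 0) := by
  by_cases hT : T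
  · have hU : ¬U := fun hU => hTU ⟨hT, hU⟩
    have h : maskedWeight p T U = fun x d => ∑ z, if (z, (0 : F)) = d then p x (z - x) else 0 := by
      funext x d
      simp only [maskedWeight, hT, hU, if_true, if_false]
      rw [← sum_shift x]
      simp
    rw [h, mutualInfo_map_injective q (fun x z => p x (z - x)) (fun z => (z, (0 : F)))
      (fun a b hab => (Prod.ext_iff.1 hab).1)]
    simp [hT, hU]
  · by_cases hU : U
    · have h : maskedWeight p T U = fun x d => ∑ y, if ((0 : F), y) = d then p x y else 0 := by
        funext x d
        simp only [maskedWeight, hT, hU, if_true, if_false]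
      rw [h, mutualInfo_map_injective q p (fun y => ((0 : F), y))
        (fun a b hab => (Prod.ext_iff.1 hab).2)]
      simp [hT, hU]
    · have h : maskedWeight p T U =
          fun x d => ∑ _u : Unit, if ((0 : F), (0 : F)) = d then ∑ y, p x y else 0 := by
        funext x d
        by_cases hd : ((0 : F), (0 : F)) = d <;> simp [maskedWeight, hT, hU, hd]
      rw [h, mutualInfo_map_injective q (fun x (_ : Unit) => ∑ y, p x y)
        (fun _ => ((0 : F), (0 : F))) (fun _ _ _ => rfl), mutualInfo_unit q _ hpsum]
      simp [hT, hU]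

theorem sum_ite_mask_eq_prod {ι : Type*} [Fintype ι] [DecidableEq ι] (p : F → F → ℝ)
    (T U : ι → Prop) [DecidablePred T] [DecidablePred U] (X : ι → F) (d : ι → F × F) :
    (∑ Y : ι → F,
      if ((fun c => if T c then X c + Y c else 0), (fun c => if U c then Y c else 0)) =
        ((fun c => (d c).1, fun c => (d c).2) : (ι → F) × (ι → F))
      then ∏ c, p (X c) (Y c) else 0) =
      ∏ c, maskedWeight p (T c) (U c) (X c) (d c) := by
  unfold maskedWeight
  rw [← sum_prod_apply (fun c y =>
    if ((if T c then X c + y else 0), (if U c then y else 0)) = d c then p (X c) y else 0)]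
  refine Finset.sum_congr rfl fun Y _ => ?_
  rw [Finset.prod_ite_zero]
  congr 1
  simp only [Prod.ext_iff, funext_iff, Finset.mem_univ, true_implies, forall_and]

end Mask

section Blocks

theorem sum_range_mul_div (n k : ℕ) (hk : 0 < k) (f : ℕ → ℝ) :
    ∑ u ∈ Finset.range (n * k), f (u / k) = k * ∑ m ∈ Finset.range n, f m := by
  induction n with
  | zero => simp
  | succ n ih =>
    rw [Nat.succ_mul, Finset.sum_range_add, ih, Finset.sum_range_succ, mul_add]
    congr 1
    rw [Finset.sum_congr rfl (g := fun _ => f n)]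
    · simp
    · intro j hj
      rw [Nat.mul_comm, Nat.mul_add_div hk, Nat.div_eq_of_lt (Finset.mem_range.1 hj), add_zero]

theorem sum_range_zmod (n : ℕ) [NeZero n] (f : ZMod n → ℝ) :
    ∑ m ∈ Finset.range n, f (m : ZMod n) = ∑ m, f m := by
  refine Finset.sum_bij' (fun m _ => (m : ZMod n)) (fun m _ => m.val) ?_ ?_ ?_ ?_ ?_
  · simp
  · intro m _
    exact Finset.mem_range.2 (ZMod.val_lt m)
  · intro m hm
    exact ZMod.val_cast_of_lt (Finset.mem_range.1 hm)
  · simp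
  · simp

/-- Summing a function of the block index over all rows. -/
theorem sum_block {n r : ℕ} (hn : 0 < n) (hr : 0 < r) (hdvd : n ∣ r) [NeZero n]
    (f : ZMod n → ℝ) :
    ∑ u : Fin r, f (((u : ℕ) / (r / n) : ℕ) : ZMod n) = (r : ℝ) / n * ∑ m, f m := by
  obtain ⟨k, rfl⟩ := hdvd
  have hk : 0 < k := Nat.pos_of_mul_pos_left hr
  rw [Nat.mul_div_cancel_left k hn,
    Fin.sum_univ_eq_sum_range (fun u => f ((u / k : ℕ) : ZMod n)),
    sum_range_mul_div n k hk (fun m => f (m : ZMod n)), sum_range_zmod]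
  have : (n : ℝ) ≠ 0 := by positivity
  push_cast
  field_simp

theorem natCast_zmod_inj_of_lt {n a b : ℕ} (ha : a < n) (hb : b < n)
    (h : (a : ZMod n) = b) : a = b := by
  rw [ZMod.natCast_eq_natCast_iff'] at h
  rwa [Nat.mod_eq_of_lt ha, Nat.mod_eq_of_lt hb] at h

theorem card_image_add_natCast {n s : ℕ} (hs : s ≤ n) (a : ZMod n) :
    ((Finset.range s).image (fun j : ℕ => a + (j : ZMod n))).card = s := by
  rw [Finset.card_image_of_injOn, Finset.card_range]
  intro x hx y hy hxy
  simp only [Finset.coe_range, Set.mem_Iio] at hx hy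
  exact natCast_zmod_inj_of_lt (hx.trans_le hs) (hy.trans_le hs) (add_left_cancel hxy)

end Blocks


/-- Let `A` be an `r × ℓ` random matrix over `F_q` whose entries, jointly
with those of `R`, are i.i.d. across positions with per-entry joint PMF `p` (so the joint
PMF of the matrices `(A, R)` is `J X Y = ∏_{pos} p (X pos) (Y pos)`). Let `ε1` and `ε2` be
the per-entry leakages, let `n` be even with `n ∣ r`, `0 ≤ ξ ≤ n/2 − 1`, and partition the
rows into `n` blocks of `r/n` rows (`blk` maps a row to its block index). Node `i` stores
the sub-shares `(A+R)_m` for `m ∈ Ti i` and `R_m` for `m ∈ Ui i`; its stored data is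
`g i X Y` (sub-share values, masked by the publicly known index sets). Then
`I_q(A;R) = r·ℓ·ε1`, `I_q(A;A+R) = r·ℓ·ε2`, and the information leaked to each node `i`
is `I_q(A; g i (A,R)) = (ξ+1)·(r·ℓ/n)·(ε1+ε2) = (ξ+1)·(L1+L2)/n`. -/
theorem statement13 {F : Type*} [Field F] [Fintype F] [DecidableEq F]
    (q r ℓ n ξ : ℕ) (hr : 0 < r) (hℓ : 0 < ℓ) (hn : 0 < n) (hneven : Even n)
    (hdvd : n ∣ r) (hξ : ξ ≤ n / 2 - 1)
    (p : F → F → ℝ) (hp : ∀ x y, 0 ≤ p x y)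
    (hpsum : ∑ x : F, ∑ y : F, p x y = 1)
    (ε1 ε2 : ℝ)
    (hε1 : ε1 = ∑ x : F, ∑ y : F, p x y *
      Real.logb q (p x y / ((∑ y' : F, p x y') * (∑ x' : F, p x' y))))
    (hε2 : ε2 = ∑ x : F, ∑ z : F, p x (z - x) *
      Real.logb q (p x (z - x) / ((∑ y' : F, p x y') * (∑ x' : F, p x' (z - x')))))
    (J : ((Fin r × Fin ℓ) → F) → ((Fin r × Fin ℓ) → F) → ℝ)
    (hJ : ∀ X Y, J X Y = ∏ pos : Fin r × Fin ℓ, p (X pos) (Y pos))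
    (blk : Fin r → ZMod n)
    (hblk : ∀ u : Fin r, blk u = (((u : ℕ) / (r / n) : ℕ) : ZMod n))
    (Ti Ui : ZMod n → Finset (ZMod n))
    (hTi : ∀ i, Ti i = (Finset.range (ξ + 1)).image (fun (j : ℕ) => i + (j : ZMod n)))
    (hUi : ∀ i, Ui i = (Finset.range (ξ + 1)).image
      (fun (j : ℕ) => ((n / 2 : ℕ) : ZMod n) + i + (j : ZMod n)))
    (g : ZMod n → ((Fin r × Fin ℓ) → F) → ((Fin r × Fin ℓ) → F) →
      ((Fin r × Fin ℓ) → F) × ((Fin r × Fin ℓ) → F))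
    (hg : ∀ i X Y, g i X Y =
      ((fun pos => if blk pos.1 ∈ Ti i then X pos + Y pos else 0),
        (fun pos => if blk pos.1 ∈ Ui i then Y pos else 0))) :
    (∑ X : (Fin r × Fin ℓ) → F, ∑ Y : (Fin r × Fin ℓ) → F,
        J X Y * Real.logb q (J X Y /
          ((∑ Y' : (Fin r × Fin ℓ) → F, J X Y') *
            (∑ X' : (Fin r × Fin ℓ) → F, J X' Y))))
      = (r : ℝ) * (ℓ : ℝ) * ε1 ∧
    (∑ X : (Fin r × Fin ℓ) → F, ∑ Z : (Fin r × Fin ℓ) → F,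
        J X (Z - X) * Real.logb q (J X (Z - X) /
          ((∑ Y' : (Fin r × Fin ℓ) → F, J X Y') *
            (∑ X' : (Fin r × Fin ℓ) → F, J X' (Z - X')))))
      = (r : ℝ) * (ℓ : ℝ) * ε2 ∧
    ∀ i : ZMod n,
      (∑ X : (Fin r × Fin ℓ) → F,
        ∑ d : ((Fin r × Fin ℓ) → F) × ((Fin r × Fin ℓ) → F),
          (∑ Y : (Fin r × Fin ℓ) → F, if g i X Y = d then J X Y else 0) *
            Real.logb q
              ((∑ Y : (Fin r × Fin ℓ) → F, if g i X Y = d then J X Y else 0) /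
                ((∑ Y' : (Fin r × Fin ℓ) → F, J X Y') *
                  (∑ X' : (Fin r × Fin ℓ) → F,
                    ∑ Y : (Fin r × Fin ℓ) → F, if g i X' Y = d then J X' Y else 0))))
        = ((ξ : ℝ) + 1) * ((r : ℝ) * (ℓ : ℝ) / (n : ℝ)) * (ε1 + ε2) := by
  have : NeZero n := ⟨hn.ne'⟩
  have hJ' : J = fun X Y => ∏ pos, p (X pos) (Y pos) := by
    funext X Y
    exact hJ X Y
  have hshift : ∀ x, ∑ z, p x (z - x) = ∑ y, p x y := fun x => sum_shift x (p x)
  have hmi1 : mutualInfo q p = ε1 := hε1.symm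
  have hmi2 : mutualInfo q (fun x z => p x (z - x)) = ε2 := by
    rw [hε2]
    unfold mutualInfo
    simp_rw [hshift]
  refine ⟨?_, ?_, fun i => ?_⟩
  · change mutualInfo q J = _
    rw [hJ', mutualInfo_prod q (fun _ => p) (fun _ => hp) (fun _ => hpsum), hmi1]
    simp
  · have h : mutualInfo q (fun X Z => J X (Z - X)) = (r : ℝ) * ℓ * ε2 := by
      rw [hJ']
      have := mutualInfo_prod (ι := Fin r × Fin ℓ) q (fun _ x z => p x (z - x))
        (fun _ x z => hp x (z - x)) (fun _ => by simpa only [hshift] using hpsum)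
      rw [hmi2] at this
      simpa using this
    rw [← h]
    unfold mutualInfo
    refine Finset.sum_congr rfl fun X _ => ?_
    rw [Fintype.sum_equiv (Equiv.subRight X) (fun Z => J X (Z - X)) (fun Y => J X Y)
      (fun _ => rfl)]
  · have hξn : ξ + 1 ≤ n / 2 := by
      obtain ⟨m, rfl⟩ := hneven
      omega
    have hdisj : ∀ m, ¬(m ∈ Ti i ∧ m ∈ Ui i) := by
      rintro m ⟨h1, h2⟩
      rw [hTi, Finset.mem_image] at h1
      rw [hUi, Finset.mem_image] at h2
      obtain ⟨a, ha, rfl⟩ := h1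
      obtain ⟨b, hb, hab⟩ := h2
      rw [Finset.mem_range] at ha hb
      have h3 : ((n / 2 + b : ℕ) : ZMod n) = (a : ℕ) := by
        push_cast
        linear_combination hab
      have := natCast_zmod_inj_of_lt (by omega) (by omega) h3
      omega
    have hcard : ∀ (S : Finset (ZMod n)), S.card = ξ + 1 → ∀ ε : ℝ,
        ∑ pos : Fin r × Fin ℓ, (if blk pos.1 ∈ S then ε else 0) =
          ((ξ : ℝ) + 1) * ((r : ℝ) * ℓ / n) * ε := by
      intro S hS ε
      rw [Fintype.sum_prod_type]
      simp_rw [hblk, Finset.sum_const, Finset.card_univ, Fintype.card_fin, nsmul_eq_mul]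
      rw [← Finset.mul_sum, sum_block hn hr hdvd (fun m => if m ∈ S then ε else 0)]
      simp [hS]
      ring
    have hW : mutualInfo q (fun X d => ∑ Y, if g i X Y = d then J X Y else 0) =
        ((ξ : ℝ) + 1) * ((r : ℝ) * ℓ / n) * (ε1 + ε2) := by
      rw [mutualInfo_arrowProd]
      simp_rw [hg, hJ, sum_ite_mask_eq_prod p (fun pos : Fin r × Fin ℓ => blk pos.1 ∈ Ti i)
        (fun pos => blk pos.1 ∈ Ui i)]
      rw [mutualInfo_prod q
        (fun pos : Fin r × Fin ℓ => maskedWeight p (blk pos.1 ∈ Ti i) (blk pos.1 ∈ Ui i))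
        (fun _ x d => Finset.sum_nonneg fun y _ => by split_ifs <;> simp [hp])
        (fun _ => by simp_rw [sum_maskedWeight, hpsum])]
      simp_rw [fun pos : Fin r × Fin ℓ => mutualInfo_maskedWeight q p hpsum (blk pos.1 ∈ Ti i)
        (blk pos.1 ∈ Ui i) (hdisj _), hmi1, hmi2]
      rw [Finset.sum_add_distrib,
        hcard _ (by rw [hTi, card_image_add_natCast (by omega)]),
        hcard _ (by rw [hUi, card_image_add_natCast (by omega)])]
      ring
    rw [← hW]
    unfold mutualInfo
    refine Finset.sum_congr rfl fun X _ => ?_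
    have hmarg : (∑ d, ∑ Y, if g i X Y = d then J X Y else 0) = ∑ Y, J X Y := by
      rw [Finset.sum_comm]
      simp
    rw [hmarg]
end
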